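/- Consider the Gaussian-design regression model with known noise variance σ² and a penalized estimator β̂(X,y) = argmin_β ‖y − Xβ‖²/σ² + Σ_j p(β_j, p_n, n) with a separable penalty p. Assume: (D1) the scalar minimizer argmin_b (u − b)² + σ²·p(b, p_n, n) is nonzero if and only if |u| > σ·h(p_n, n) for some threshold function h; and for all sequences β^{(n)} ∈ B(p_n, s_n) with dimension/sparsity configurations (s_n, p_n) in a set 𝒟: (D2) P(‖β̂ − β^{(n)}‖ ≤ r_n) → 1 for a rate r_n = r_n(n, p_n, s_n); (D3) P(‖β̂‖_0 ≤ C_0·s_n) → 1 for some C_0 > 0; (D4) P(ξ(β̂) = ξ(β^{(n)})) → 1 whenever ‖β^{(n)}‖_min ≥ t(n, s_n, p_n) for some function t. Then for every sequence β^{(n)} ∈ B(p_n, s_n) with (s_n, p_n) in 𝒟 ∩ 𝒟̃, where 𝒟̃ = {(s_n, p_n) : limsup s_n/p_n ≤ c < 1, p_n → ∞, and √(s_n)·log(p_n)·r_n → 0}, one has P(FP(β̂) = 0) → 1. -/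

import Mathlib

open MeasureTheory ProbabilityTheory Filter
open scoped ENNReal

/-- Gaussian random-design regression model with noise variance `σ²`:
the joint law of `(X, y)` where `X` has i.i.d. `N(0,1)` entries,
`ε ~ N(0, σ² I_n)` independent of `X`, and `y = Xβ + ε`. -/
noncomputable def gaussDesignVar (n p : ℕ) (σ2 : NNReal) (β : Fin p → ℝ) :
    Measure ((Fin n → Fin p → ℝ) × (Fin n → ℝ)) :=
  ((Measure.pi fun _ : Fin n => Measure.pi fun _ : Fin p => gaussianReal 0 1).prod
      (Measure.pi fun _ : Fin n => gaussianReal 0 σ2)).map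
    fun Xe => (Xe.1, fun i => (∑ j, Xe.1 i j * β j) + Xe.2 i)

/-- `B(p,s)`: vectors in `ℝ^p` with at most `s` nonzero coordinates. -/
def SparseV (p s : ℕ) : Set (Fin p → ℝ) := {β | {j | β j ≠ 0}.ncard ≤ s}

/-- `‖θ‖₀`, the number of nonzero coordinates. -/
noncomputable def supp0 {p : ℕ} (θ : Fin p → ℝ) : ℕ := {j | θ j ≠ 0}.ncard

/-- Number of false positives. -/
noncomputable def FPc {p : ℕ} (b β : Fin p → ℝ) : ℕ :=
  {j | b j ≠ 0 ∧ β j = 0}.ncard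

/-- `bh` is (a selection of) the separably penalized estimator
`argmin_β ‖y − Xβ‖²/σ² + Σ_j p(β_j, p_n, n)`. -/
def IsSepPenEst (n p : ℕ) (σ : ℝ) (pfun : ℝ → ℕ → ℕ → ℝ)
    (bh : (Fin n → Fin p → ℝ) × (Fin n → ℝ) → Fin p → ℝ) : Prop :=
  ∀ w : (Fin n → Fin p → ℝ) × (Fin n → ℝ), ∀ θ : Fin p → ℝ,
    (∑ i, (w.2 i - ∑ j, w.1 i j * bh w j) ^ 2) / σ ^ 2 + (∑ j, pfun (bh w j) p n) ≤
      (∑ i, (w.2 i - ∑ j, w.1 i j * θ j) ^ 2) / σ ^ 2 + (∑ j, pfun (θ j) p n)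

theorem pi_withDensity_prod {ι : Type*} [Fintype ι] {α : ι → Type*}
    [∀ i, MeasurableSpace (α i)] (μ : ∀ i, Measure (α i)) [∀ i, IsProbabilityMeasure (μ i)]
    (f : ∀ i, α i → ℝ≥0∞) (hf : ∀ i, Measurable (f i))
    [∀ i, SigmaFinite ((μ i).withDensity (f i))] :
    Measure.pi (fun i => (μ i).withDensity (f i)) =
      (Measure.pi μ).withDensity (fun x => ∏ i, f i (x i)) := by
  refine Measure.pi_eq fun s hs => ?_
  rw [withDensity_apply _ (MeasurableSet.univ_pi hs),
    ← lintegral_indicator (MeasurableSet.univ_pi hs)]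
  have key : ∀ x : ∀ i, α i, (Set.univ.pi s).indicator (fun x => ∏ i, f i (x i)) x =
      ∏ i, (s i).indicator (f i) (x i) := by
    intro x
    by_cases hx : x ∈ Set.univ.pi s
    · rw [Set.indicator_of_mem hx]
      exact Finset.prod_congr rfl fun i _ => (Set.indicator_of_mem (hx i trivial) _).symm
    · rw [Set.indicator_of_notMem hx]
      simp only [Set.mem_pi, Set.mem_univ, true_implies, not_forall] at hx
      obtain ⟨i, hi⟩ := hx
      exact (Finset.prod_eq_zero (Finset.mem_univ i) (Set.indicator_of_notMem hi _)).symm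
  simp_rw [key]
  have hm : ∀ i, Measurable ((s i).indicator (f i)) := fun i => (hf i).indicator (hs i)
  rw [lintegral_prod_eq_prod_lintegral_of_indepFun Finset.univ
    (fun i (x : ∀ i, α i) => (s i).indicator (f i) (x i))
    (iIndepFun_pi fun i => (hm i).aemeasurable) (fun i => (hm i).comp (measurable_pi_apply i))]
  refine Finset.prod_congr rfl fun i _ => ?_
  rw [(measurePreserving_eval μ i).lintegral_comp (hm i), lintegral_indicator (hs i),
    withDensity_apply _ (hs i)]

theorem gaussianReal_eq_withDensity_gaussianReal_zero (d : ℝ) {v : NNReal} (hv : v ≠ 0) :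
    gaussianReal d v = (gaussianReal 0 v).withDensity
      (fun x => ENNReal.ofReal (Real.exp ((d * x - d ^ 2 / 2) / v))) := by
  have hv' : (v : ℝ) ≠ 0 := by exact_mod_cast hv
  rw [gaussianReal_of_var_ne_zero _ hv, gaussianReal_of_var_ne_zero _ hv,
    ← withDensity_mul _ (measurable_gaussianPDF _ _) (by fun_prop)]
  congr 1
  ext x
  simp only [Pi.mul_apply, gaussianPDF, gaussianPDFReal]
  rw [← ENNReal.ofReal_mul (by positivity), mul_assoc (_⁻¹), ← Real.exp_add]
  congr 3
  field_simp
  ring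

/-- Quasi-invariance of a centred Gaussian product measure under translation by `d`, on a set
where the linear functional `⟨·, d⟩` is bounded above. -/
theorem pi_gaussianReal_le_translate {n : ℕ} {v : NNReal} (hv : v ≠ 0) (d : Fin n → ℝ)
    {E : Set (Fin n → ℝ)} (hE : MeasurableSet E) {M : ℝ}
    (hM : ∀ x ∈ E, ∑ i, d i * x i ≤ M) :
    Measure.pi (fun _ : Fin n => gaussianReal 0 v) E ≤
      ENNReal.ofReal (Real.exp ((M + (∑ i, d i ^ 2) / 2) / v)) *
        Measure.pi (fun _ : Fin n => gaussianReal 0 v) ((fun x i => x i - d i) ⁻¹' E) := by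
  have hv' : (0 : ℝ) < v := by positivity
  have hmap : (Measure.pi (fun _ : Fin n => gaussianReal 0 v)).map (fun x i => x i - d i) =
      (Measure.pi (fun _ : Fin n => gaussianReal 0 v)).withDensity (fun x =>
        ∏ i, ENNReal.ofReal (Real.exp (((-d i) * x i - (-d i) ^ 2 / 2) / v))) := by
    have hs : ∀ i, (gaussianReal 0 v).map (fun x => x - d i) = gaussianReal (-d i) v := by
      intro i
      rw [gaussianReal_map_sub_const, zero_sub]
    have : ∀ i, SigmaFinite ((gaussianReal 0 v).map (fun x => x - d i)) := by
      intro i; rw [hs]; infer_instance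
    rw [Measure.pi_map_pi (f := fun i x => x - d i) (fun i => by fun_prop)]
    simp_rw [hs]
    have : ∀ i, SigmaFinite ((gaussianReal 0 v).withDensity
      (fun x => ENNReal.ofReal (Real.exp (((-d i) * x - (-d i) ^ 2 / 2) / v)))) := by
      intro i
      rw [← gaussianReal_eq_withDensity_gaussianReal_zero _ hv]; infer_instance
    rw [← pi_withDensity_prod _ (fun i x =>
      ENNReal.ofReal (Real.exp (((-d i) * x - (-d i) ^ 2 / 2) / v))) (fun i => by fun_prop)]
    congr 1
    ext i : 1
    exact gaussianReal_eq_withDensity_gaussianReal_zero _ hv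
  rw [← Measure.map_apply (by fun_prop) hE, hmap, withDensity_apply _ hE,
    ← lintegral_const_mul _ (by fun_prop)]
  calc _ = ∫⁻ _ in E, 1 ∂(Measure.pi (fun _ : Fin n => gaussianReal 0 v)) := by simp
    _ ≤ _ := by
      refine setLIntegral_mono (by fun_prop) fun x hx => ?_
      rw [← ENNReal.ofReal_prod_of_nonneg (fun i _ => (Real.exp_pos _).le),
        ← ENNReal.ofReal_mul (Real.exp_pos _).le, ← Real.exp_sum, ← Real.exp_add,
        ENNReal.one_le_ofReal, Real.one_le_exp_iff, ← Finset.sum_div, ← add_div]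
      refine div_nonneg ?_ hv'.le
      have h1 := hM x hx
      have h2 : ∑ i, (-d i * x i - (-d i) ^ 2 / 2) =
          -(∑ i, d i * x i) - (∑ i, d i ^ 2) / 2 := by
        rw [Finset.sum_div, ← Finset.sum_neg_distrib, ← Finset.sum_sub_distrib]
        exact Finset.sum_congr rfl fun i _ => by ring
      rw [h2]
      linarith

theorem pi_gaussianReal_tail {n : ℕ} {v : NNReal} {x : Fin n → ℝ} (hx : ∑ i, x i ^ 2 = 1)
    {L : ℝ} (hL : 0 ≤ L) :
    Measure.pi (fun _ : Fin n => gaussianReal 0 v) {e | L ≤ ∑ i, x i * e i} ≤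
      ENNReal.ofReal (Real.exp (-L ^ 2 / (2 * v))) := by
  have hsub : ∀ i, HasSubgaussianMGF (fun e : Fin n → ℝ => x i * e i)
      (⟨x i ^ 2, sq_nonneg _⟩ * v) (Measure.pi fun _ : Fin n => gaussianReal 0 v) := by
    intro i
    have hl : (Measure.pi fun _ : Fin n => gaussianReal 0 v).map (fun e => x i * e i) =
        gaussianReal 0 (⟨x i ^ 2, sq_nonneg _⟩ * v) := by
      have h1 := (measurePreserving_eval (fun _ : Fin n => gaussianReal 0 v) i).map_eq
      have h2 := Measure.map_map (μ := Measure.pi fun _ : Fin n => gaussianReal 0 v)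
        (g := fun y : ℝ => x i * y) (f := Function.eval i) (by fun_prop) (by fun_prop)
      rw [h1, gaussianReal_map_const_mul, mul_zero] at h2
      exact h2.symm
    refine ⟨fun t => ?_, fun t => ?_⟩
    · rw [← mgf_pos_iff, mgf_gaussianReal hl]
      exact Real.exp_pos _
    · rw [mgf_gaussianReal hl]
      simp
  have := HasSubgaussianMGF.measure_sum_ge_le_of_iIndepFun (s := Finset.univ)
    (iIndepFun_pi (μ := fun _ : Fin n => gaussianReal 0 v) (X := fun i y => x i * y)
      fun i => by fun_prop) (fun i _ => hsub i) hL
  rw [← ofReal_measureReal]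
  refine ENNReal.ofReal_le_ofReal (this.trans (le_of_eq ?_))
  congr 3
  push_cast
  change ∑ i, x i ^ 2 * (v : ℝ) = v
  rw [← Finset.sum_mul, hx, one_mul]

/-- Anti-concentration for maxima of linear functionals of a Gaussian vector: the tubular
neighbourhood of the boundary of a polytope has small Gaussian measure compared with the measure of
the complement of the polytope. -/
theorem pi_gaussianReal_anticoncentration {ι : Type*} [LinearOrder ι] {n : ℕ} {v : NNReal}
    (hv : v ≠ 0) (T : Finset ι) (x : ι → Fin n → ℝ) (hx : ∀ j ∈ T, ∑ i, x j i ^ 2 = 1)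
    (τ : ι → ℝ) {δ L : ℝ} (hδ : 0 < δ) (hL : 0 ≤ L) :
    Measure.pi (fun _ : Fin n => gaussianReal 0 v) {e | ∃ j ∈ T, τ j - δ ≤ ∑ i, x j i * e i} ≤
      ENNReal.ofReal (Real.exp ((3 * δ * L + 9 * δ ^ 2 / 2) / v)) *
        Measure.pi (fun _ : Fin n => gaussianReal 0 v)
          {e | ∃ j ∈ T, τ j + δ < ∑ i, x j i * e i} +
      T.card * ENNReal.ofReal (Real.exp (-L ^ 2 / (2 * v))) := by
  set γ := Measure.pi (fun _ : Fin n => gaussianReal 0 v)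
  set K := ENNReal.ofReal (Real.exp ((3 * δ * L + 9 * δ ^ 2 / 2) / v))
  let f : ι → (Fin n → ℝ) → ℝ := fun j e => ∑ i, x j i * e i - τ j
  have hf : ∀ j, Measurable (f j) := fun j => by fun_prop
  let C : ι → Set (Fin n → ℝ) := fun j =>
    {e | (∀ i ∈ T, f i e ≤ f j e) ∧ ∀ i ∈ T, i < j → f i e < f j e}
  let E : ι → Set (Fin n → ℝ) := fun j => C j ∩ {e | -δ ≤ f j e ∧ ∑ i, x j i * e i ≤ L}
  have hCm : ∀ j, MeasurableSet (C j) := fun j => by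
    have : C j = (⋂ i ∈ T, {e | f i e ≤ f j e}) ∩ ⋂ i ∈ T, ⋂ _ : i < j, {e | f i e < f j e} := by
      ext e; simp [C]
    rw [this]
    exact (Finset.measurableSet_biInter _ fun i _ => measurableSet_le (hf i) (hf j)).inter
      (Finset.measurableSet_biInter _ fun i _ => MeasurableSet.iInter fun _ =>
        measurableSet_lt (hf i) (hf j))
  have hEm : ∀ j, MeasurableSet (E j) := fun j =>
    (hCm j).inter ((measurableSet_le measurable_const (hf j)).inter
      (measurableSet_le (f := fun e : Fin n → ℝ => ∑ i, x j i * e i) (by fun_prop)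
        measurable_const))
  let F : ι → Set (Fin n → ℝ) := fun j => (fun e i => e i - 3 * δ * x j i) ⁻¹' E j
  have hFm : ∀ j, MeasurableSet (F j) := fun j => (hEm j).preimage (by fun_prop)
  have hshift : ∀ i j e, f i (fun k => e k - 3 * δ * x j k) =
      f i e - 3 * δ * ∑ k, x i k * x j k := by
    intro i j e
    simp only [f, mul_sub, Finset.sum_sub_distrib, Finset.mul_sum]
    have : ∀ k, x i k * (3 * δ * x j k) = 3 * δ * (x i k * x j k) := fun k => by ring
    simp_rw [this]
    ring
  have hself : ∀ j ∈ T, ∑ k, x j k * x j k = 1 := fun j hj => by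
    rw [← hx j hj]; exact Finset.sum_congr rfl fun k _ => (sq _).symm
  have hcs : ∀ i ∈ T, ∀ j ∈ T, ∑ k, x i k * x j k ≤ 1 := by
    intro i hi j hj
    have h2 : ∑ k, x i k * x j k ≤ ∑ k, (x i k ^ 2 + x j k ^ 2) / 2 :=
      Finset.sum_le_sum fun k _ => by nlinarith [sq_nonneg (x i k - x j k)]
    rw [← Finset.sum_div, Finset.sum_add_distrib, hx i hi, hx j hj] at h2
    linarith
  have hFC : ∀ j ∈ T, F j ⊆ C j ∩ {e | δ < f j e} := by
    intro j hj e he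
    obtain ⟨⟨h1, h2⟩, h3, -⟩ := he
    have hjj := hshift j j e
    rw [hself j hj] at hjj
    refine ⟨⟨fun i hi => ?_, fun i hi hij => ?_⟩, ?_⟩
    · have := h1 i hi
      rw [hjj, hshift] at this
      nlinarith [hcs i hi j hj]
    · have := h2 i hi hij
      rw [hjj, hshift] at this
      nlinarith [hcs i hi j hj]
    · rw [hjj] at h3
      simp only [Set.mem_ofPred_eq]
      linarith
  have hCd : (T : Set ι).PairwiseDisjoint C := by
    intro i hi j hj hij
    refine Set.disjoint_left.2 fun e hei hej => ?_
    rcases lt_or_gt_of_ne hij with h | h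
    · exact absurd (hej.2 i hi h) (not_lt.2 (hei.1 j hj))
    · exact absurd (hei.2 j hj h) (not_lt.2 (hej.1 i hi))
  have hEF : ∀ j ∈ T, γ (E j) ≤ K * γ (F j) := by
    intro j hj
    have := pi_gaussianReal_le_translate hv (fun i => 3 * δ * x j i) (hEm j) (M := 3 * δ * L)
      (fun e he => by
        simp_rw [mul_assoc (3 * δ), ← Finset.mul_sum]
        exact mul_le_mul_of_nonneg_left he.2.2 (by positivity))
    simp_rw [mul_pow _ (x j _), ← Finset.mul_sum, hx j hj] at this
    refine this.trans (le_of_eq ?_)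
    congr 5
    ring
  have hcover : {e | ∃ j ∈ T, τ j - δ ≤ ∑ i, x j i * e i} ⊆
      (⋃ j ∈ T, E j) ∪ ⋃ j ∈ T, {e | L ≤ ∑ i, x j i * e i} := by
    rintro e ⟨j₀, hj₀, h₀⟩
    obtain ⟨m, hm, hmax⟩ := T.exists_max_image (fun j => f j e) ⟨j₀, hj₀⟩
    have hne : (T.filter fun j => f j e = f m e).Nonempty := ⟨m, by simp [hm]⟩
    obtain ⟨hJT, hJ⟩ := Finset.mem_filter.1 (Finset.min'_mem _ hne)
    set J := (T.filter fun j => f j e = f m e).min' hne with hJdef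
    by_cases hJL : ∑ i, x J i * e i ≤ L
    · refine Or.inl (Set.mem_biUnion hJT ⟨⟨fun i hi => hJ ▸ hmax i hi, fun i hi hiJ => ?_⟩, ?_, hJL⟩)
      · refine lt_of_le_of_ne (hJ ▸ hmax i hi) fun h => ?_
        exact absurd (Finset.min'_le _ i (Finset.mem_filter.2 ⟨hi, h.trans hJ⟩)) (not_le.2 hiJ)
      · have := hmax j₀ hj₀
        rw [← hJ] at this
        refine le_trans ?_ this
        simp only [f]
        linarith
    · exact Or.inr (Set.mem_biUnion hJT (le_of_lt (not_le.1 hJL)))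
  calc γ {e | ∃ j ∈ T, τ j - δ ≤ ∑ i, x j i * e i}
      ≤ γ (⋃ j ∈ T, E j) + γ (⋃ j ∈ T, {e | L ≤ ∑ i, x j i * e i}) :=
        (measure_mono hcover).trans (measure_union_le _ _)
    _ ≤ (∑ j ∈ T, γ (E j)) + ∑ j ∈ T, γ {e | L ≤ ∑ i, x j i * e i} :=
        add_le_add (measure_biUnion_finset_le _ _) (measure_biUnion_finset_le _ _)
    _ ≤ (∑ j ∈ T, K * γ (F j)) + ∑ _j ∈ T, ENNReal.ofReal (Real.exp (-L ^ 2 / (2 * v))) :=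
        add_le_add (Finset.sum_le_sum hEF)
          (Finset.sum_le_sum fun j hj => pi_gaussianReal_tail (hx j hj) hL)
    _ ≤ _ := by
        rw [← Finset.mul_sum, Finset.sum_const, nsmul_eq_mul, ← measure_biUnion_finset
          (fun i hi j hj hij => (hCd hi hj hij).mono (fun e he => (hFC i hi he).1)
            (fun e he => (hFC j hj he).1)) (fun j _ => hFm j)]
        gcongr
        refine Set.iUnion₂_subset fun j hj e he => ⟨j, hj, ?_⟩
        have := (hFC j hj he).2
        simp only [f, Set.mem_ofPred_eq] at this
        linarith

/-- Averaged form of `pi_gaussianReal_anticoncentration`, with random directions and thresholds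
independent of the Gaussian vector. -/
theorem prod_pi_gaussianReal_anticoncentration {Ω ι : Type*} [MeasurableSpace Ω] (P : Measure Ω)
    [IsProbabilityMeasure P] [LinearOrder ι] {n : ℕ} {v : NNReal}
    (hv : v ≠ 0) (T : Finset ι) (x : ι → Ω → Fin n → ℝ) (hxm : ∀ j, Measurable (x j))
    (hx : ∀ᵐ ω ∂P, ∀ j ∈ T, ∑ i, x j ω i ^ 2 = 1)
    (τ : ι → Ω → ℝ) (hτ : ∀ j, Measurable (τ j)) {δ L : ℝ} (hδ : 0 < δ) (hL : 0 ≤ L) :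
    P.prod (Measure.pi (fun _ : Fin n => gaussianReal 0 v))
        {w | ∃ j ∈ T, τ j w.1 - δ ≤ ∑ i, x j w.1 i * w.2 i} ≤
      ENNReal.ofReal (Real.exp ((3 * δ * L + 9 * δ ^ 2 / 2) / v)) *
        P.prod (Measure.pi (fun _ : Fin n => gaussianReal 0 v))
          {w | ∃ j ∈ T, τ j w.1 + δ < ∑ i, x j w.1 i * w.2 i} +
      T.card * ENNReal.ofReal (Real.exp (-L ^ 2 / (2 * v))) := by
  have hz : ∀ j, Measurable fun w : Ω × (Fin n → ℝ) => ∑ i, x j w.1 i * w.2 i := fun j =>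
    Finset.measurable_sum _ fun i _ =>
      ((measurable_pi_apply i).comp ((hxm j).comp measurable_fst)).mul
        ((measurable_pi_apply i).comp measurable_snd)
  have hm1 : MeasurableSet {w : Ω × (Fin n → ℝ) |
      ∃ j ∈ T, τ j w.1 - δ ≤ ∑ i, x j w.1 i * w.2 i} := by
    have : {w : Ω × (Fin n → ℝ) | ∃ j ∈ T, τ j w.1 - δ ≤ ∑ i, x j w.1 i * w.2 i} =
        ⋃ j ∈ T, {w | τ j w.1 - δ ≤ ∑ i, x j w.1 i * w.2 i} := by ext; simp
    rw [this]
    exact Finset.measurableSet_biUnion _ fun j _ =>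
      measurableSet_le (((hτ j).comp measurable_fst).sub_const _) (hz j)
  have hm2 : MeasurableSet {w : Ω × (Fin n → ℝ) |
      ∃ j ∈ T, τ j w.1 + δ < ∑ i, x j w.1 i * w.2 i} := by
    have : {w : Ω × (Fin n → ℝ) | ∃ j ∈ T, τ j w.1 + δ < ∑ i, x j w.1 i * w.2 i} =
        ⋃ j ∈ T, {w | τ j w.1 + δ < ∑ i, x j w.1 i * w.2 i} := by ext; simp
    rw [this]
    exact Finset.measurableSet_biUnion _ fun j _ =>
      measurableSet_lt (((hτ j).comp measurable_fst).add_const _) (hz j)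
  rw [Measure.prod_apply hm1, Measure.prod_apply hm2,
    ← lintegral_const_mul _ (measurable_measure_prodMk_left hm2)]
  calc _ ≤ ∫⁻ ω, (ENNReal.ofReal (Real.exp ((3 * δ * L + 9 * δ ^ 2 / 2) / v)) *
        Measure.pi (fun _ : Fin n => gaussianReal 0 v) (Prod.mk ω ⁻¹'
          {w | ∃ j ∈ T, τ j w.1 + δ < ∑ i, x j w.1 i * w.2 i}) +
        T.card * ENNReal.ofReal (Real.exp (-L ^ 2 / (2 * v)))) ∂P := by
        refine lintegral_mono_ae ?_
        filter_upwards [hx] with ω hω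
        exact pi_gaussianReal_anticoncentration hv T (fun j => x j ω) hω (fun j => τ j ω) hδ hL
    _ = _ := by
        rw [lintegral_add_right _ measurable_const, lintegral_const, measure_univ, mul_one]

theorem pi_gaussianReal_abs_tail {n : ℕ} (a : Fin n → ℝ) {Λ : ℝ} (hΛ : 0 ≤ Λ) :
    Measure.pi (fun _ : Fin n => gaussianReal 0 1)
        {e | Real.sqrt (∑ i, a i ^ 2) * Λ < |∑ i, a i * e i|} ≤
      2 * ENNReal.ofReal (Real.exp (-Λ ^ 2 / 2)) := by
  set N := Real.sqrt (∑ i, a i ^ 2) with hN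
  have hsum : 0 ≤ ∑ i, a i ^ 2 := Finset.sum_nonneg fun i _ => sq_nonneg _
  rcases (Real.sqrt_nonneg (∑ i, a i ^ 2)).eq_or_lt with h0 | hpos
  · have ha : ∀ i, a i = 0 := by
      have h1 : ∑ i, a i ^ 2 = 0 := (Real.sqrt_eq_zero hsum).1 h0.symm
      intro i
      have := (Finset.sum_eq_zero_iff_of_nonneg fun i _ => sq_nonneg (a i)).1 h1 i
        (Finset.mem_univ i)
      exact pow_eq_zero_iff two_ne_zero |>.1 this
    have : {e : Fin n → ℝ | N * Λ < |∑ i, a i * e i|} = ∅ := by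
      ext e
      simp [ha, hN]
    rw [this, measure_empty]
    exact zero_le
  · rw [← hN] at hpos
    have hunit : ∀ s : ℝ, s ^ 2 = 1 → ∑ i, (s * (a i / N)) ^ 2 = 1 := by
      intro s hs
      simp_rw [mul_pow, hs, one_mul, div_pow, ← Finset.sum_div]
      rw [hN, Real.sq_sqrt hsum, div_self]
      intro h
      rw [hN, h, Real.sqrt_zero] at hpos
      exact lt_irrefl _ hpos
    have h1 := pi_gaussianReal_tail (v := 1) (hunit 1 (by norm_num)) hΛ
    have h2 := pi_gaussianReal_tail (v := 1) (hunit (-1) (by norm_num)) hΛ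
    rw [NNReal.coe_one, mul_one] at h1 h2
    refine (measure_mono ?_).trans ((measure_union_le _ _).trans
      ((add_le_add h1 h2).trans (two_mul _).ge))
    intro e he
    have hs : ∀ s : ℝ, ∑ i, s * (a i / N) * e i = s * (∑ i, a i * e i) / N := by
      intro s
      rw [Finset.mul_sum, Finset.sum_div]
      exact Finset.sum_congr rfl fun i _ => by ring
    simp only [Set.mem_union, Set.mem_ofPred_eq, hs] at he ⊢
    rw [le_div_iff₀ hpos, le_div_iff₀ hpos]
    rcases lt_abs.1 he with h | h
    · left; linarith
    · right; linarith

/-- The law of a Gaussian design matrix with i.i.d. standard normal entries. -/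
noncomputable def gaussDesignMatrix (n p : ℕ) : Measure (Fin n → Fin p → ℝ) :=
  Measure.pi fun _ : Fin n => Measure.pi fun _ : Fin p => gaussianReal 0 1

instance (n p : ℕ) : IsProbabilityMeasure (gaussDesignMatrix n p) := by
  unfold gaussDesignMatrix; infer_instance

/-- Euclidean norm of the `j`-th column. -/
noncomputable def colNorm {n p : ℕ} (X : Fin n → Fin p → ℝ) (j : Fin p) : ℝ :=
  Real.sqrt (∑ i, X i j ^ 2)

theorem measurable_colNorm {n p : ℕ} (j : Fin p) :
    Measurable fun X : Fin n → Fin p → ℝ => colNorm X j := by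
  unfold colNorm; fun_prop

theorem colNorm_sq {n p : ℕ} (X : Fin n → Fin p → ℝ) (j : Fin p) :
    colNorm X j ^ 2 = ∑ i, X i j ^ 2 :=
  Real.sq_sqrt (Finset.sum_nonneg fun _ _ => sq_nonneg _)

theorem gaussDesignMatrix_map_cols {n p : ℕ} {j k : Fin p} (hjk : j ≠ k) :
    (gaussDesignMatrix n p).map (fun X => (fun i => X i j, fun i => X i k)) =
      (Measure.pi fun _ : Fin n => gaussianReal 0 1).prod
        (Measure.pi fun _ : Fin n => gaussianReal 0 1) := by
  have hrow : (Measure.pi fun _ : Fin p => gaussianReal 0 1).map (fun r => (r j, r k)) =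
      (gaussianReal 0 1).prod (gaussianReal 0 1) := by
    have hind := (iIndepFun_pi (μ := fun _ : Fin p => gaussianReal 0 1) (X := fun _ y => y)
      fun i => by fun_prop).indepFun hjk
    rw [(indepFun_iff_map_prod_eq_prod_map_map (measurable_pi_apply j).aemeasurable
      (measurable_pi_apply k).aemeasurable).1 hind]
    congr 1
    · exact (measurePreserving_eval (fun _ : Fin p => gaussianReal 0 1) j).map_eq
    · exact (measurePreserving_eval (fun _ : Fin p => gaussianReal 0 1) k).map_eq
  have hrows : (gaussDesignMatrix n p).map (fun X i => (X i j, X i k)) =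
      Measure.pi fun _ : Fin n => (gaussianReal 0 1).prod (gaussianReal 0 1) := by
    have : ∀ _ : Fin n, SigmaFinite
        ((Measure.pi fun _ : Fin p => gaussianReal 0 1).map (fun r => (r j, r k))) := by
      intro _; rw [hrow]; infer_instance
    unfold gaussDesignMatrix
    rw [Measure.pi_map_pi (f := fun _ (r : Fin p → ℝ) => (r j, r k)) (fun i => by fun_prop)]
    simp_rw [hrow]
  have h := (measurePreserving_arrowProdEquivProdArrow ℝ ℝ (Fin n)
    (fun _ => gaussianReal 0 1) (fun _ => gaussianReal 0 1)).map_eq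
  rw [← h, ← hrows, Measure.map_map (MeasurableEquiv.measurable _) (by fun_prop)]
  rfl

theorem gaussDesignMatrix_cross_le {n p : ℕ} {j k : Fin p} (hjk : j ≠ k) {Λ : ℝ} (hΛ : 0 ≤ Λ) :
    gaussDesignMatrix n p {X | colNorm X j * Λ < |∑ i, X i j * X i k|} ≤
      2 * ENNReal.ofReal (Real.exp (-Λ ^ 2 / 2)) := by
  let S : Set ((Fin n → ℝ) × (Fin n → ℝ)) :=
    {w | Real.sqrt (∑ i, w.1 i ^ 2) * Λ < |∑ i, w.1 i * w.2 i|}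
  have hS : MeasurableSet S := measurableSet_lt (by fun_prop)
    ((show Measurable fun w : (Fin n → ℝ) × (Fin n → ℝ) => ∑ i, w.1 i * w.2 i by
      fun_prop).norm)
  change gaussDesignMatrix n p ((fun X => (fun i => X i j, fun i => X i k)) ⁻¹' S) ≤ _
  rw [← Measure.map_apply (by fun_prop) hS, gaussDesignMatrix_map_cols hjk, Measure.prod_apply hS]
  calc _ ≤ ∫⁻ _ : Fin n → ℝ, 2 * ENNReal.ofReal (Real.exp (-Λ ^ 2 / 2))
        ∂(Measure.pi fun _ : Fin n => gaussianReal 0 1) :=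
        lintegral_mono fun a => pi_gaussianReal_abs_tail a hΛ
    _ = _ := by rw [lintegral_const, measure_univ, mul_one]

theorem gaussDesignMatrix_incoherence {n p : ℕ} {Λ : ℝ} (hΛ : 0 ≤ Λ) :
    gaussDesignMatrix n p {X | ∃ j k, j ≠ k ∧ colNorm X j * Λ < |∑ i, X i j * X i k|} ≤
      p * (p * (2 * ENNReal.ofReal (Real.exp (-Λ ^ 2 / 2)))) := by
  have hsub : {X : Fin n → Fin p → ℝ |
        ∃ j k, j ≠ k ∧ colNorm X j * Λ < |∑ i, X i j * X i k|} ⊆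
      ⋃ j ∈ (Finset.univ : Finset (Fin p)), ⋃ k ∈ (Finset.univ : Finset (Fin p)),
        {X | j ≠ k ∧ colNorm X j * Λ < |∑ i, X i j * X i k|} := by
    intro X hX
    simpa using hX
  refine (measure_mono hsub).trans ((measure_biUnion_finset_le _ _).trans ?_)
  have hbound : ∀ j k : Fin p, gaussDesignMatrix n p
      {X | j ≠ k ∧ colNorm X j * Λ < |∑ i, X i j * X i k|} ≤
      2 * ENNReal.ofReal (Real.exp (-Λ ^ 2 / 2)) := by
    intro j k
    by_cases hjk : j = k
    · simp [hjk]
    · exact (measure_mono fun X hX => hX.2).trans (gaussDesignMatrix_cross_le hjk hΛ)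
  calc _ ≤ ∑ _j : Fin p, ∑ _k : Fin p, 2 * ENNReal.ofReal (Real.exp (-Λ ^ 2 / 2)) :=
        Finset.sum_le_sum fun j _ => (measure_biUnion_finset_le _ _).trans
          (Finset.sum_le_sum fun k _ => hbound j k)
    _ = _ := by simp

theorem gaussDesignMatrix_colNorm_pos {n p : ℕ} (hn : 0 < n) :
    ∀ᵐ X ∂(gaussDesignMatrix n p), ∀ j, 0 < colNorm X j := by
  rw [ae_all_iff]
  intro j
  have hent : ∀ᵐ X ∂(gaussDesignMatrix n p), X ⟨0, hn⟩ j ≠ 0 := by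
    have h1 : ∀ᵐ x ∂(gaussianReal 0 1), x ≠ (0 : ℝ) := by
      have := nullSingletonClass_gaussianReal (μ := 0) (v := 1) one_ne_zero
      simp [ae_iff]
    have h2 := (measurePreserving_eval (fun _ : Fin p => gaussianReal 0 1)
      j).quasiMeasurePreserving.ae h1
    exact (measurePreserving_eval (fun _ : Fin n => Measure.pi fun _ : Fin p => gaussianReal 0 1)
      ⟨0, hn⟩).quasiMeasurePreserving.ae h2
  filter_upwards [hent] with X hX
  refine Real.sqrt_pos.2 (lt_of_lt_of_le (pow_pos (abs_pos.2 hX) 2) ?_)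
  rw [sq_abs]
  exact Finset.single_le_sum (f := fun i => X i j ^ 2) (fun i _ => sq_nonneg _)
    (Finset.mem_univ (⟨0, hn⟩ : Fin n))

/-- Largest value of the correlation with the residual below which `0` beats every positive `b` in
the scalar problem `a b² - 2 b z + v q(b)`. -/
noncomputable def coordThr (q : ℝ → ℝ) (v a : ℝ) : EReal :=
  ⨅ b : Set.Ioi (0 : ℝ), (((a * b + v * (q b - q 0) / b) / 2 : ℝ) : EReal)

theorem measurable_coordThr (q : ℝ → ℝ) (v : ℝ) : Measurable (coordThr q v) := by
  refine Monotone.measurable fun a a' h => iInf_mono fun b => ?_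
  have hb : (0 : ℝ) < b := b.2
  rw [EReal.coe_le_coe_iff]
  gcongr

theorem coordThr_ne_top (q : ℝ → ℝ) (v a : ℝ) : coordThr q v a ≠ ⊤ :=
  ne_top_of_le_ne_top (EReal.coe_ne_top _) (iInf_le _ (⟨1, Set.mem_Ioi.2 one_pos⟩ : Set.Ioi (0 : ℝ)))

theorem le_coordThr {q : ℝ → ℝ} {v a y : ℝ}
    (h : ∀ b, 0 < b → 2 * b * y ≤ a * b ^ 2 + v * (q b - q 0)) :
    coordThr q v a ≠ ⊥ ∧ y ≤ (coordThr q v a).toReal := by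
  have hy : (y : EReal) ≤ coordThr q v a := by
    refine le_iInf fun b => ?_
    have hb : (0 : ℝ) < b := b.2
    rw [EReal.coe_le_coe_iff, le_div_iff₀ two_pos]
    have h1 : (a * b + v * (q b - q 0) / b) = (a * (b : ℝ) ^ 2 + v * (q b - q 0)) / b := by
      field_simp
    rw [h1, le_div_iff₀ hb]
    linarith [h b hb]
  have hbot : coordThr q v a ≠ ⊥ := ne_bot_of_le_ne_bot (EReal.coe_ne_bot y) hy
  refine ⟨hbot, ?_⟩
  rwa [← EReal.coe_toReal (coordThr_ne_top q v a) hbot, EReal.coe_le_coe_iff] at hy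

theorem coordThr_le {q : ℝ → ℝ} {v a z b : ℝ} (hbot : coordThr q v a ≠ ⊥) (hb : 0 < b)
    (h : a * b ^ 2 + v * (q b - q 0) ≤ 2 * b * z) : (coordThr q v a).toReal ≤ z := by
  have hz : coordThr q v a ≤ (z : EReal) := by
    refine (iInf_le _ (⟨b, hb⟩ : Set.Ioi (0 : ℝ))).trans ?_
    rw [EReal.coe_le_coe_iff, div_le_iff₀ two_pos]
    have h1 : (a * b + v * (q b - q 0) / b) = (a * b ^ 2 + v * (q b - q 0)) / b := by
      field_simp
    change a * b + v * (q b - q 0) / b ≤ _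
    rw [h1, div_le_iff₀ hb]
    linarith
  rwa [← EReal.coe_toReal (coordThr_ne_top q v a) hbot, EReal.coe_le_coe_iff] at hz

/-- Contribution of the other columns to the correlation of column `j` with `X δ`. -/
noncomputable def crossTerm {n p : ℕ} (X : Fin n → Fin p → ℝ) (j : Fin p) (δ : Fin p → ℝ) : ℝ :=
  ∑ k ∈ Finset.univ.erase j, (∑ i, X i j * X i k) * δ k

theorem abs_crossTerm_le {n p : ℕ} {X : Fin n → Fin p → ℝ} {j : Fin p} {δ : Fin p → ℝ}
    {Λ m r : ℝ} (hΛ : 0 ≤ Λ)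
    (hX : ∀ k, j ≠ k → |∑ i, X i j * X i k| ≤ colNorm X j * Λ)
    (hcard : ({k | δ k ≠ 0}.ncard : ℝ) ≤ m) (hr : Real.sqrt (∑ k, δ k ^ 2) ≤ r) :
    |crossTerm X j δ| ≤ colNorm X j * (Λ * Real.sqrt m * r) := by
  classical
  have hN : 0 ≤ colNorm X j := Real.sqrt_nonneg _
  have h1 : |crossTerm X j δ| ≤ colNorm X j * Λ * ∑ k, |δ k| := by
    rw [Finset.mul_sum]
    refine (Finset.abs_sum_le_sum_abs _ _).trans ((Finset.sum_le_sum fun k hk => ?_).trans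
      (Finset.sum_le_sum_of_subset_of_nonneg (Finset.erase_subset _ _)
        fun k _ _ => by positivity))
    rw [abs_mul]
    exact mul_le_mul_of_nonneg_right (hX k (Finset.ne_of_mem_erase hk).symm) (abs_nonneg _)
  have h2 : ∑ k, |δ k| ≤ Real.sqrt m * r := by
    set A := Finset.univ.filter fun k => δ k ≠ 0 with hA
    have hAc : (A.card : ℝ) ≤ m := by
      rw [← Set.ncard_coe_finset A]
      simpa [hA] using hcard
    have hs : ∑ k, |δ k| = ∑ k ∈ A, |δ k| := by
      refine (Finset.sum_subset (Finset.subset_univ A) fun k _ hk => ?_).symm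
      simpa [hA] using hk
    have hsq : (∑ k ∈ A, |δ k|) ^ 2 ≤ A.card * ∑ k, δ k ^ 2 := by
      refine sq_sum_le_card_mul_sum_sq.trans ?_
      simp_rw [sq_abs]
      exact mul_le_mul_of_nonneg_left (Finset.sum_le_sum_of_subset_of_nonneg
        (Finset.subset_univ A) fun k _ _ => sq_nonneg _) (Nat.cast_nonneg _)
    rw [hs]
    calc ∑ k ∈ A, |δ k| ≤ Real.sqrt (A.card * ∑ k, δ k ^ 2) := Real.le_sqrt_of_sq_le hsq
      _ = Real.sqrt A.card * Real.sqrt (∑ k, δ k ^ 2) := Real.sqrt_mul (Nat.cast_nonneg _) _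
      _ ≤ Real.sqrt m * r :=
        mul_le_mul (Real.sqrt_le_sqrt hAc) hr (Real.sqrt_nonneg _) (Real.sqrt_nonneg _)
  calc _ ≤ colNorm X j * Λ * ∑ k, |δ k| := h1
    _ ≤ colNorm X j * Λ * (Real.sqrt m * r) := mul_le_mul_of_nonneg_left h2 (by positivity)
    _ = _ := by ring

/-- Coordinatewise optimality of a separably penalized least squares estimator at a coordinate
outside the support of the true signal. -/
theorem IsSepPenEst.coord_le {n p : ℕ} {σ : ℝ} (hσ : 0 < σ) {pfun : ℝ → ℕ → ℕ → ℝ}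
    {bh : (Fin n → Fin p → ℝ) × (Fin n → ℝ) → Fin p → ℝ} (hb : IsSepPenEst n p σ pfun bh)
    (X : Fin n → Fin p → ℝ) (ε : Fin n → ℝ) (β : Fin p → ℝ) {j : Fin p} (hj : β j = 0)
    {θ : Fin p → ℝ} (hθ : θ = bh (X, fun i => (∑ k, X i k * β k) + ε i)) (b : ℝ) :
    colNorm X j ^ 2 * θ j ^ 2 -
        2 * θ j * (∑ i, X i j * ε i + crossTerm X j (fun k => β k - θ k)) +
        σ ^ 2 * pfun (θ j) p n ≤
      colNorm X j ^ 2 * b ^ 2 -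
        2 * b * (∑ i, X i j * ε i + crossTerm X j (fun k => β k - θ k)) +
        σ ^ 2 * pfun b p n := by
  classical
  have hmin := hb (X, fun i => (∑ k, X i k * β k) + ε i) (Function.update θ j b)
  rw [← hθ] at hmin
  simp only at hmin
  set u : Fin n → ℝ := fun i =>
    ((∑ k, X i k * β k) + ε i) - ∑ k ∈ Finset.univ.erase j, X i k * θ k with hu
  have hz : ∑ i, X i j * u i =
      ∑ i, X i j * ε i + crossTerm X j (fun k => β k - θ k) := by
    have hui : ∀ i, u i = ε i + ∑ k ∈ Finset.univ.erase j, X i k * (β k - θ k) := by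
      intro i
      have : ∑ k, X i k * β k = ∑ k ∈ Finset.univ.erase j, X i k * β k := by
        rw [← Finset.add_sum_erase _ _ (Finset.mem_univ j), hj, mul_zero, zero_add]
      simp only [hu, this, mul_sub, Finset.sum_sub_distrib]
      ring
    simp_rw [hui, mul_add, Finset.sum_add_distrib, crossTerm, Finset.mul_sum, Finset.sum_mul]
    rw [Finset.sum_comm]
    congr 1
    exact Finset.sum_congr rfl fun k _ => Finset.sum_congr rfl fun i _ => by ring
  have hquad : ∀ c : ℝ, ∑ i, (u i - X i j * c) ^ 2 =
      ∑ i, u i ^ 2 + (colNorm X j ^ 2 * c ^ 2 - 2 * c * ∑ i, X i j * u i) := by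
    intro c
    rw [colNorm_sq, Finset.sum_mul, Finset.mul_sum, ← Finset.sum_sub_distrib,
      ← Finset.sum_add_distrib]
    exact Finset.sum_congr rfl fun i _ => by ring
  have hres1 : ∀ i, ((∑ k, X i k * β k) + ε i) - ∑ k, X i k * θ k = u i - X i j * θ j := by
    intro i
    rw [← Finset.add_sum_erase _ (fun k => X i k * θ k) (Finset.mem_univ j)]
    simp only [hu]
    ring
  have hres2 : ∀ i, ((∑ k, X i k * β k) + ε i) - ∑ k, X i k * Function.update θ j b k =
      u i - X i j * b := by
    intro i
    rw [← Finset.add_sum_erase _ (fun k => X i k * Function.update θ j b k) (Finset.mem_univ j),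
      Function.update_self]
    have : ∑ k ∈ Finset.univ.erase j, X i k * Function.update θ j b k =
        ∑ k ∈ Finset.univ.erase j, X i k * θ k :=
      Finset.sum_congr rfl fun k hk => by
        rw [Function.update_of_ne (Finset.ne_of_mem_erase hk)]
    rw [this]
    simp only [hu]
    ring
  have hpen : ∑ k, pfun (Function.update θ j b k) p n =
      pfun b p n + ∑ k ∈ Finset.univ.erase j, pfun (θ k) p n := by
    rw [← Finset.add_sum_erase _ _ (Finset.mem_univ j), Function.update_self]
    congr 1
    exact Finset.sum_congr rfl fun k hk => by
      rw [Function.update_of_ne (Finset.ne_of_mem_erase hk)]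
  simp_rw [hres1, hres2, hquad, hpen] at hmin
  rw [← Finset.add_sum_erase _ (fun k => pfun (θ k) p n) (Finset.mem_univ j), hz] at hmin
  have hσ2 : 0 < σ ^ 2 := by positivity
  rw [div_add' _ _ _ hσ2.ne', div_add' _ _ _ hσ2.ne', div_le_div_iff_of_pos_right hσ2] at hmin
  linarith

/-- Normalised `j`-th column of the design, multiplied by the sign `s`. -/
noncomputable def signedDir {n p : ℕ} (s : ℝ) (j : Fin p) (X : Fin n → Fin p → ℝ) : Fin n → ℝ :=
  fun i => s * (X i j / colNorm X j)

/-- Threshold for the correlation of the noise with `signedDir s j X`. -/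
noncomputable def signedThr {n p : ℕ} (q : ℝ → ℝ) (v s : ℝ) (j : Fin p)
    (X : Fin n → Fin p → ℝ) : ℝ :=
  (coordThr (fun b => q (s * b)) v (colNorm X j ^ 2)).toReal / colNorm X j

theorem measurable_signedDir {n p : ℕ} (s : ℝ) (j : Fin p) :
    Measurable (signedDir (n := n) s j) := by
  have := measurable_colNorm (n := n) j
  unfold signedDir
  fun_prop

theorem measurable_signedThr {n p : ℕ} (q : ℝ → ℝ) (v s : ℝ) (j : Fin p) :
    Measurable (signedThr (n := n) q v s j) :=
  (((measurable_coordThr (fun b => q (s * b)) v).comp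
    ((measurable_colNorm j).pow_const 2)).ereal_toReal).div (measurable_colNorm j)

theorem sum_signedDir_sq {n p : ℕ} {s : ℝ} (hs : s ^ 2 = 1) {j : Fin p} {X : Fin n → Fin p → ℝ}
    (hX : 0 < colNorm X j) : ∑ i, signedDir s j X i ^ 2 = 1 := by
  simp_rw [signedDir, mul_pow, hs, one_mul, div_pow, ← Finset.sum_div]
  rw [← colNorm_sq, div_self (by positivity)]

theorem sum_signedDir_mul {n p : ℕ} (s : ℝ) (j : Fin p) (X : Fin n → Fin p → ℝ)
    (ε : Fin n → ℝ) :
    ∑ i, signedDir s j X i * ε i = s * (∑ i, X i j * ε i) / colNorm X j := by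
  rw [Finset.mul_sum, Finset.sum_div]
  exact Finset.sum_congr rfl fun i _ => by rw [signedDir]; ring

theorem IsSepPenEst.dir_le_of_eq_zero {n p : ℕ} {σ : ℝ} (hσ : 0 < σ) {pfun : ℝ → ℕ → ℕ → ℝ}
    {bh : (Fin n → Fin p → ℝ) × (Fin n → ℝ) → Fin p → ℝ} (hb : IsSepPenEst n p σ pfun bh)
    (X : Fin n → Fin p → ℝ) (ε : Fin n → ℝ) (β : Fin p → ℝ) {j : Fin p} (hj : β j = 0)
    {θ : Fin p → ℝ} (hθ : θ = bh (X, fun i => (∑ k, X i k * β k) + ε i)) (hθj : θ j = 0)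
    (hX : 0 < colNorm X j) {δ : ℝ}
    (hc : |crossTerm X j (fun k => β k - θ k)| ≤ colNorm X j * δ) {s : ℝ} (hs : |s| = 1) :
    coordThr (fun b => pfun (s * b) p n) (σ ^ 2) (colNorm X j ^ 2) ≠ ⊥ ∧
      ∑ i, signedDir s j X i * ε i ≤
        signedThr (fun b => pfun b p n) (σ ^ 2) s j X + δ := by
  have hs2 : s ^ 2 = 1 := by rw [← sq_abs, hs, one_pow]
  have key := le_coordThr (q := fun b => pfun (s * b) p n) (v := σ ^ 2) (a := colNorm X j ^ 2)
    (y := s * (∑ i, X i j * ε i + crossTerm X j (fun k => β k - θ k))) (by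
      intro b _
      have := hb.coord_le hσ X ε β hj hθ (s * b)
      rw [hθj, mul_pow, hs2] at this
      simp only [mul_zero]
      linarith)
  refine ⟨key.1, ?_⟩
  rw [sum_signedDir_mul, signedThr, div_add' _ _ _ hX.ne', div_le_div_iff_of_pos_right hX]
  have h2 : -(s * crossTerm X j (fun k => β k - θ k)) ≤ colNorm X j * δ := by
    refine (neg_le_abs _).trans ?_
    rwa [abs_mul, hs, one_mul]
  linarith [key.2]

theorem IsSepPenEst.le_dir_of_ne_zero {n p : ℕ} {σ : ℝ} (hσ : 0 < σ) {pfun : ℝ → ℕ → ℕ → ℝ}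
    {bh : (Fin n → Fin p → ℝ) × (Fin n → ℝ) → Fin p → ℝ} (hb : IsSepPenEst n p σ pfun bh)
    (X : Fin n → Fin p → ℝ) (ε : Fin n → ℝ) (β : Fin p → ℝ) {j : Fin p} (hj : β j = 0)
    {θ : Fin p → ℝ} (hθ : θ = bh (X, fun i => (∑ k, X i k * β k) + ε i)) (hθj : θ j ≠ 0)
    (hX : 0 < colNorm X j) {δ : ℝ}
    (hc : |crossTerm X j (fun k => β k - θ k)| ≤ colNorm X j * δ)
    (hbot : ∀ s : ℝ, |s| = 1 →
      coordThr (fun b => pfun (s * b) p n) (σ ^ 2) (colNorm X j ^ 2) ≠ ⊥) :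
    ∃ s : ℝ, (s = 1 ∨ s = -1) ∧
      signedThr (fun b => pfun b p n) (σ ^ 2) s j X - δ ≤ ∑ i, signedDir s j X i * ε i := by
  have key : ∀ s : ℝ, |s| = 1 → 0 < s * θ j →
      signedThr (fun b => pfun b p n) (σ ^ 2) s j X - δ ≤ ∑ i, signedDir s j X i * ε i := by
    intro s hs hpos
    have hs2 : s ^ 2 = 1 := by rw [← sq_abs, hs, one_pow]
    have hss : s * (s * θ j) = θ j := by rw [← mul_assoc, ← sq, hs2, one_mul]
    have h1 := coordThr_le (z := s * (∑ i, X i j * ε i + crossTerm X j (fun k => β k - θ k)))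
      (hbot s hs) hpos (by
        have := hb.coord_le hσ X ε β hj hθ 0
        rw [hss, mul_zero, mul_pow, hs2]
        have e : 2 * (s * θ j) * (s * (∑ i, X i j * ε i + crossTerm X j (fun k => β k - θ k))) =
          s ^ 2 * (2 * θ j * (∑ i, X i j * ε i + crossTerm X j (fun k => β k - θ k))) := by ring
        rw [e, hs2]
        linarith)
    rw [sum_signedDir_mul, signedThr, div_sub' hX.ne', div_le_div_iff_of_pos_right hX]
    have h2 : s * crossTerm X j (fun k => β k - θ k) ≤ colNorm X j * δ := by
      refine (le_abs_self _).trans ?_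
      rwa [abs_mul, hs, one_mul]
    linarith
  rcases lt_or_gt_of_ne hθj with h | h
  · exact ⟨-1, Or.inr rfl, key _ (by simp) (by linarith)⟩
  · exact ⟨1, Or.inl rfl, key _ (by simp) (by linarith)⟩

/-- The observation `(X, Xβ + ε)` as a function of the design and the noise. -/
def regObs {n p : ℕ} (β : Fin p → ℝ) (w : (Fin n → Fin p → ℝ) × (Fin n → ℝ)) :
    (Fin n → Fin p → ℝ) × (Fin n → ℝ) :=
  (w.1, fun i => (∑ j, w.1 i j * β j) + w.2 i)

theorem measurable_regObs {n p : ℕ} (β : Fin p → ℝ) :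
    Measurable (regObs (n := n) β) := by
  unfold regObs; fun_prop

theorem gaussDesignVar_eq_map_regObs (n p : ℕ) (v : NNReal) (β : Fin p → ℝ) :
    gaussDesignVar n p v β = ((gaussDesignMatrix n p).prod
      (Measure.pi fun _ : Fin n => gaussianReal 0 v)).map (regObs β) := rfl

instance (n p : ℕ) (v : NNReal) (β : Fin p → ℝ) :
    IsProbabilityMeasure (gaussDesignVar n p v β) := by
  rw [gaussDesignVar_eq_map_regObs]
  exact Measure.isProbabilityMeasure_map (measurable_regObs β).aemeasurable

/-- Any event determined by the support of a measurable random vector is measurable. -/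
theorem measurableSet_support_mem {Ω : Type*} [MeasurableSpace Ω] {p : ℕ} {b : Ω → Fin p → ℝ}
    (hb : Measurable b) (Q : Set (Fin p) → Prop) : MeasurableSet {w | Q {j | b w j ≠ 0}} := by
  classical
  have hj : ∀ j, MeasurableSet {w | b w j ≠ 0} := fun j =>
    (((measurable_pi_apply j).comp hb) (measurableSet_singleton (0 : ℝ))).compl
  have hA : ∀ A : Set (Fin p), MeasurableSet {w | {j | b w j ≠ 0} = A} := by
    intro A
    have : {w | {j | b w j ≠ 0} = A} =
        ⋂ j, if j ∈ A then {w | b w j ≠ 0} else {w | b w j ≠ 0}ᶜ := by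
      ext w
      simp only [Set.mem_ofPred_eq, Set.mem_iInter, Set.ext_iff]
      refine forall_congr' fun j => ?_
      by_cases h : j ∈ A <;> simp [h]
    rw [this]
    refine MeasurableSet.iInter fun j => ?_
    split_ifs
    · exact hj j
    · exact (hj j).compl
  have : {w | Q {j | b w j ≠ 0}} = ⋃ A ∈ {A | Q A}, {w | {j | b w j ≠ 0} = A} := by
    ext w; simp
  rw [this]
  exact MeasurableSet.biUnion (Set.to_countable _) fun A _ => hA A

/-- Non-asymptotic comparison: the probability of a false positive under `β` is controlled by the
failure probabilities of the estimation and selection events under `β` and under a signal `β'`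
with the same support. -/
theorem measure_falsePositive_le {n p s : ℕ} (hn : 0 < n) {σ : ℝ} (hσ : 0 < σ)
    {pfun : ℝ → ℕ → ℕ → ℝ} {bh : (Fin n → Fin p → ℝ) × (Fin n → ℝ) → Fin p → ℝ}
    (hb : IsSepPenEst n p σ pfun bh) {C0 : ℝ} (hC0 : 0 < C0) {r δ L Λ : ℝ} (hδ : 0 < δ)
    (hL : 0 ≤ L) (hΛ : 0 ≤ Λ) (hr : Λ * Real.sqrt ((1 + C0) * s) * r ≤ δ)
    {β β' : Fin p → ℝ} (hβ : β ∈ SparseV p s) (hββ' : ∀ j, β' j = 0 ↔ β j = 0)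
    {v : NNReal} (hv : v ≠ 0)
    {μ : Measure ((Fin n → Fin p → ℝ) × (Fin n → ℝ))}
    (hμ : μ = (gaussDesignMatrix n p).prod (Measure.pi fun _ : Fin n => gaussianReal 0 v))
    {B : ℝ≥0∞} (hB : B = μ {w | ¬ Real.sqrt (∑ j, (bh (regObs β' w) j - β' j) ^ 2) ≤ r} +
      μ {w | ¬ {j | bh (regObs β' w) j ≠ 0} = {j | β' j ≠ 0}} +
      p * (p * (2 * ENNReal.ofReal (Real.exp (-Λ ^ 2 / 2))))) :
    μ {w | ¬ FPc (bh (regObs β w)) β = 0} ≤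
      μ {w | ¬ Real.sqrt (∑ j, (bh (regObs β w) j - β j) ^ 2) ≤ r} +
      μ {w | ¬ (supp0 (bh (regObs β w)) : ℝ) ≤ C0 * s} + B +
      2 * (ENNReal.ofReal (Real.exp ((3 * δ * L + 9 * δ ^ 2 / 2) / v)) * B +
        p * ENNReal.ofReal (Real.exp (-L ^ 2 / (2 * v)))) := by
  classical
  let q : ℝ → ℝ := fun b => pfun b p n
  let T : Finset (Fin p) := Finset.univ.filter fun j => β j = 0
  let W : ℝ → Set ((Fin n → Fin p → ℝ) × (Fin n → ℝ)) := fun s =>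
    {w | ∃ j ∈ T, signedThr q (σ ^ 2) s j w.1 - δ ≤ ∑ i, signedDir s j w.1 i * w.2 i}
  let V : ℝ → Set ((Fin n → Fin p → ℝ) × (Fin n → ℝ)) := fun s =>
    {w | ∃ j ∈ T, signedThr q (σ ^ 2) s j w.1 + δ < ∑ i, signedDir s j w.1 i * w.2 i}
  let A : Set ((Fin n → Fin p → ℝ) × (Fin n → ℝ)) :=
    {w | ¬ Real.sqrt (∑ j, (bh (regObs β' w) j - β' j) ^ 2) ≤ r}
  let S : Set ((Fin n → Fin p → ℝ) × (Fin n → ℝ)) :=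
    {w | ¬ {j | bh (regObs β' w) j ≠ 0} = {j | β' j ≠ 0}}
  let I : Set ((Fin n → Fin p → ℝ) × (Fin n → ℝ)) :=
    {w | ∃ j k, j ≠ k ∧ colNorm w.1 j * Λ < |∑ i, w.1 i j * w.1 i k|}
  let Z : Set ((Fin n → Fin p → ℝ) × (Fin n → ℝ)) := {w | ¬ ∀ j, 0 < colNorm w.1 j}
  have hfst : MeasurePreserving Prod.fst μ (gaussDesignMatrix n p) := by
    rw [hμ]; exact measurePreserving_fst
  have hIle : μ I ≤ p * (p * (2 * ENNReal.ofReal (Real.exp (-Λ ^ 2 / 2)))) := by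
    refine le_trans ?_ (gaussDesignMatrix_incoherence (n := n) (p := p) hΛ)
    rw [← hfst.map_eq]
    exact Measure.le_map_apply measurable_fst.aemeasurable _
  have hZ0 : μ Z = 0 :=
    ae_iff.1 (hfst.quasiMeasurePreserving.ae (gaussDesignMatrix_colNorm_pos hn))
  have hBt : μ (A ∪ S ∪ I ∪ Z) ≤ B := by
    refine (measure_union_le _ _).trans ?_
    rw [hZ0, add_zero, hB]
    exact (measure_union_le _ _).trans (add_le_add (measure_union_le _ _) hIle)
  have hcardβ : ({j | β j ≠ 0}.ncard : ℝ) ≤ s := by exact_mod_cast hβ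
  have hs0 : (0 : ℝ) ≤ C0 * s := by positivity
  have hscale : ∀ {N : ℝ}, 0 < N → N * (Λ * Real.sqrt ((1 + C0) * s) * r) ≤ N * δ :=
    fun hN => mul_le_mul_of_nonneg_left hr hN.le
  have hstrong : ∀ w ∉ A ∪ S ∪ I ∪ Z, ∀ j, β j = 0 → ∀ t : ℝ, |t| = 1 →
      coordThr (fun b => q (t * b)) (σ ^ 2) (colNorm w.1 j ^ 2) ≠ ⊥ ∧
        ∑ i, signedDir t j w.1 i * w.2 i ≤ signedThr q (σ ^ 2) t j w.1 + δ := by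
    intro w hw j hj t ht
    simp only [A, S, I, Z, Set.mem_union, Set.mem_ofPred_eq, not_or, not_not, not_exists,
      not_and, not_lt] at hw
    obtain ⟨⟨⟨hA, hS⟩, hI⟩, hZ⟩ := hw
    have hsupp : ∀ k, β k = 0 → bh (regObs β' w) k = 0 := by
      intro k hk
      by_contra h
      have : k ∈ {j | β' j ≠ 0} := hS ▸ h
      exact this ((hββ' k).2 hk)
    refine hb.dir_le_of_eq_zero hσ w.1 w.2 β' ((hββ' j).2 hj) (θ := bh (regObs β' w)) rfl
      (hsupp j hj) (hZ j) ((abs_crossTerm_le (m := (1 + C0) * s) (r := r) hΛ (hI j) ?_ ?_).trans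
        (hscale (hZ j))) ht
    · have : {k | β' k - bh (regObs β' w) k ≠ 0} ⊆ {k | β k ≠ 0} := by
        intro k hk hk0
        exact hk (by rw [(hββ' k).2 hk0, hsupp k hk0, sub_zero])
      have h1 : ({k | β' k - bh (regObs β' w) k ≠ 0}.ncard : ℝ) ≤ {k | β k ≠ 0}.ncard := by
        exact_mod_cast Set.ncard_le_ncard this (Set.toFinite _)
      linarith
    · refine le_trans (le_of_eq ?_) hA
      congr 1
      exact Finset.sum_congr rfl fun k _ => by ring
  have hV : ∀ t : ℝ, |t| = 1 → V t ⊆ A ∪ S ∪ I ∪ Z := by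
    rintro t ht w ⟨j, hj, hlt⟩
    by_contra hw
    exact absurd hlt (not_lt.2 (hstrong w hw j (Finset.mem_filter.1 hj).2 t ht).2)
  have hcover : {w | ¬ FPc (bh (regObs β w)) β = 0} ⊆
      {w | ¬ Real.sqrt (∑ j, (bh (regObs β w) j - β j) ^ 2) ≤ r} ∪
      {w | ¬ (supp0 (bh (regObs β w)) : ℝ) ≤ C0 * s} ∪ (A ∪ S ∪ I ∪ Z) ∪ (W 1 ∪ W (-1)) := by
    intro w hw
    by_contra hcon
    have h1 := fun h => hcon (Or.inl (Or.inl (Or.inl h)))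
    have h2 := fun h => hcon (Or.inl (Or.inl (Or.inr h)))
    have h3 : w ∉ A ∪ S ∪ I ∪ Z := fun h => hcon (Or.inl (Or.inr h))
    have h4 : w ∉ W 1 ∪ W (-1) := fun h => hcon (Or.inr h)
    rw [imp_false, Set.mem_ofPred_eq, not_not] at h1 h2
    have hne : {j | bh (regObs β w) j ≠ 0 ∧ β j = 0}.Nonempty := by
      rw [Set.nonempty_iff_ne_empty]
      intro h
      exact hw (by rw [FPc, h, Set.ncard_empty])
    obtain ⟨j, hθj, hj⟩ := hne
    have h3' := h3
    simp only [A, S, I, Z, Set.mem_union, Set.mem_ofPred_eq, not_or, not_not, not_exists,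
      not_and, not_lt] at h3'
    obtain ⟨⟨-, hI⟩, hZ⟩ := h3'
    obtain ⟨t, ht, hle⟩ := hb.le_dir_of_ne_zero hσ w.1 w.2 β hj (θ := bh (regObs β w)) rfl hθj
      (hZ j) ((abs_crossTerm_le (m := (1 + C0) * s) (r := r) hΛ (hI j) (by
        have hsub : {k | β k - bh (regObs β w) k ≠ 0} ⊆
            {k | β k ≠ 0} ∪ {k | bh (regObs β w) k ≠ 0} := by
          intro k hk
          by_contra hk'
          simp only [Set.mem_union, Set.mem_ofPred_eq, not_or, not_not] at hk'
          exact hk (by rw [hk'.1, hk'.2, sub_zero])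
        have hcard : ({k | β k - bh (regObs β w) k ≠ 0}.ncard : ℝ) ≤
            {k | β k ≠ 0}.ncard + {k | bh (regObs β w) k ≠ 0}.ncard := by
          exact_mod_cast (Set.ncard_le_ncard hsub (Set.toFinite _)).trans (Set.ncard_union_le _ _)
        have h2' : ({k | bh (regObs β w) k ≠ 0}.ncard : ℝ) ≤ C0 * s := h2
        linarith) (by
        refine le_trans (le_of_eq ?_) h1
        congr 1
        exact Finset.sum_congr rfl fun k _ => by ring)).trans (hscale (hZ j)))
      (fun t ht => (hstrong w h3 j hj t ht).1)
    refine h4 ?_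
    rcases ht with rfl | rfl
    · exact Or.inl ⟨j, by simp [T, hj], hle⟩
    · exact Or.inr ⟨j, by simp [T, hj], hle⟩
  have hW : ∀ t : ℝ, |t| = 1 → μ (W t) ≤
      ENNReal.ofReal (Real.exp ((3 * δ * L + 9 * δ ^ 2 / 2) / v)) * B +
        p * ENNReal.ofReal (Real.exp (-L ^ 2 / (2 * v))) := by
    intro t ht
    have h := prod_pi_gaussianReal_anticoncentration (gaussDesignMatrix n p) hv T
      (fun j => signedDir t j) (fun j => measurable_signedDir t j) (by
        filter_upwards [gaussDesignMatrix_colNorm_pos (p := p) hn] with X hX j _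
        exact sum_signedDir_sq (by rw [← sq_abs, ht, one_pow]) (hX j))
      (fun j => signedThr q (σ ^ 2) t j) (fun j => measurable_signedThr q (σ ^ 2) t j) hδ hL
    rw [← hμ] at h
    refine h.trans (add_le_add ?_ ?_)
    · gcongr
      exact (measure_mono (hV t ht)).trans hBt
    · gcongr
      exact (Finset.card_le_univ T).trans (by simp)
  refine (measure_mono hcover).trans ((measure_union_le _ _).trans (add_le_add ?_ ?_))
  · exact (measure_union_le _ _).trans (add_le_add (measure_union_le _ _) hBt)
  · rw [two_mul]
    exact (measure_union_le _ _).trans (add_le_add (hW 1 (by simp)) (hW (-1) (by simp)))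

/-- Choice of tuning constants in `measure_falsePositive_le` in terms of `log p`. -/
theorem measure_falsePositive_le_of_log {n p s : ℕ} (hn : 0 < n) (hp : 1 ≤ Real.log p)
    {σ : ℝ} (hσ : 0 < σ)
    {pfun : ℝ → ℕ → ℕ → ℝ} {bh : (Fin n → Fin p → ℝ) × (Fin n → ℝ) → Fin p → ℝ}
    (hb : IsSepPenEst n p σ pfun bh) {C0 : ℝ} (hC0 : 0 < C0) {r : ℝ}
    (hr : 3 * Real.sqrt (1 + C0) * (Real.sqrt s * Real.log p * r) ≤ 1)
    {β β' : Fin p → ℝ} (hβ : β ∈ SparseV p s) (hββ' : ∀ j, β' j = 0 ↔ β j = 0)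
    {μ : Measure ((Fin n → Fin p → ℝ) × (Fin n → ℝ))}
    (hμ : μ = (gaussDesignMatrix n p).prod
      (Measure.pi fun _ : Fin n => gaussianReal 0 (Real.toNNReal (σ ^ 2))))
    {B : ℝ≥0∞} (hB : B = μ {w | ¬ Real.sqrt (∑ j, (bh (regObs β' w) j - β' j) ^ 2) ≤ r} +
      μ {w | ¬ {j | bh (regObs β' w) j ≠ 0} = {j | β' j ≠ 0}} + 2 * (p : ℝ≥0∞)⁻¹) :
    μ {w | ¬ FPc (bh (regObs β w)) β = 0} ≤
      μ {w | ¬ Real.sqrt (∑ j, (bh (regObs β w) j - β j) ^ 2) ≤ r} +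
      μ {w | ¬ (supp0 (bh (regObs β w)) : ℝ) ≤ C0 * s} + B +
      2 * (ENNReal.ofReal (Real.exp ((6 * σ + 9 / 2) / σ ^ 2)) * B + (p : ℝ≥0∞)⁻¹) := by
  have hp0 : (0 : ℝ) < p := by
    rcases Nat.eq_zero_or_pos p with h | h
    · rw [h] at hp; norm_num at hp
    · exact_mod_cast h
  have hlog : 0 < Real.log p := by linarith
  set l := Real.sqrt (Real.log p) with hl
  have hl2 : l ^ 2 = Real.log p := Real.sq_sqrt hlog.le
  have hl1 : 1 ≤ l := by rw [hl, Real.one_le_sqrt]; exact hp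
  have hl0 : 0 < l := by linarith
  have hv : Real.toNNReal (σ ^ 2) ≠ 0 := by
    rw [ne_eq, Real.toNNReal_eq_zero, not_le]; positivity
  have hvc : ((Real.toNNReal (σ ^ 2) : NNReal) : ℝ) = σ ^ 2 := Real.coe_toNNReal _ (sq_nonneg _)
  have hexp : ∀ k : ℕ, ENNReal.ofReal (Real.exp (-(k * Real.log p))) = ((p : ℝ≥0∞)⁻¹) ^ k := by
    intro k
    rw [Real.exp_neg, Real.exp_nat_mul, Real.exp_log hp0, ENNReal.ofReal_inv_of_pos (by positivity),
      ENNReal.ofReal_pow hp0.le, ENNReal.ofReal_natCast, ENNReal.inv_pow]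
  have hpne : (p : ℝ≥0∞) ≠ 0 := by
    have : p ≠ 0 := by rintro rfl; simp at hp0
    exact_mod_cast this
  have hcancel : (p : ℝ≥0∞) * (p : ℝ≥0∞)⁻¹ = 1 :=
    ENNReal.mul_inv_cancel hpne (ENNReal.natCast_ne_top p)
  have main := measure_falsePositive_le (δ := 1 / l) (L := 2 * σ * l) (Λ := 3 * l) hn hσ hb hC0
    (by positivity) (by positivity) (by positivity) (r := r) (s := s) (by
      rw [Real.sqrt_mul (by positivity), le_div_iff₀ hl0]
      calc _ = 3 * Real.sqrt (1 + C0) * (Real.sqrt s * l ^ 2 * r) := by ring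
        _ ≤ 1 := by rw [hl2]; exact hr) hβ hββ' hv hμ rfl
  have hinc : (p : ℝ≥0∞) * (p * (2 * ENNReal.ofReal (Real.exp (-(3 * l) ^ 2 / 2)))) ≤
      2 * (p : ℝ≥0∞)⁻¹ := by
    have h1 : ENNReal.ofReal (Real.exp (-(3 * l) ^ 2 / 2)) ≤ ((p : ℝ≥0∞)⁻¹) ^ 3 := by
      rw [← hexp]
      refine ENNReal.ofReal_le_ofReal (Real.exp_le_exp.2 ?_)
      rw [mul_pow, hl2]
      push_cast
      linarith
    calc _ ≤ (p : ℝ≥0∞) * (p * (2 * ((p : ℝ≥0∞)⁻¹) ^ 3)) := by gcongr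
      _ = 2 * (p : ℝ≥0∞)⁻¹ * ((p : ℝ≥0∞) * (p : ℝ≥0∞)⁻¹) * ((p : ℝ≥0∞) * (p : ℝ≥0∞)⁻¹) := by ring
      _ = 2 * (p : ℝ≥0∞)⁻¹ := by rw [hcancel, mul_one, mul_one]
  have htail : (p : ℝ≥0∞) * ENNReal.ofReal
      (Real.exp (-(2 * σ * l) ^ 2 / (2 * (Real.toNNReal (σ ^ 2) : NNReal)))) ≤
      (p : ℝ≥0∞)⁻¹ := by
    have h1 : -(2 * σ * l) ^ 2 / (2 * (Real.toNNReal (σ ^ 2) : NNReal)) =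
        -((2 : ℕ) * Real.log p) := by
      rw [hvc, ← hl2]
      push_cast
      field_simp
    rw [h1, hexp, sq, ← mul_assoc, hcancel, one_mul]
  have hK : ENNReal.ofReal (Real.exp ((3 * (1 / l) * (2 * σ * l) + 9 * (1 / l) ^ 2 / 2) /
      (Real.toNNReal (σ ^ 2) : NNReal))) ≤ ENNReal.ofReal (Real.exp ((6 * σ + 9 / 2) / σ ^ 2)) := by
    refine ENNReal.ofReal_le_ofReal (Real.exp_le_exp.2 ?_)
    rw [hvc]
    have h1 : 3 * (1 / l) * (2 * σ * l) = 6 * σ := by field_simp; norm_num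
    have h2 : (1 / l) ^ 2 ≤ 1 := pow_le_one₀ (by positivity) (by rw [div_le_one hl0]; exact hl1)
    rw [h1]
    gcongr
    linarith
  have hBle : μ {w | ¬ Real.sqrt (∑ j, (bh (regObs β' w) j - β' j) ^ 2) ≤ r} +
      μ {w | ¬ {j | bh (regObs β' w) j ≠ 0} = {j | β' j ≠ 0}} +
      p * (p * (2 * ENNReal.ofReal (Real.exp (-(3 * l) ^ 2 / 2)))) ≤ B := by
    rw [hB]; gcongr
  refine main.trans ?_
  gcongr

/-- An event of probability tending to one in the regression model, expressed through the
probability of its complement in terms of the design and the noise. -/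
theorem tendsto_prod_compl_of_tendsto_gaussDesignVar {p : ℕ → ℕ} {v : NNReal}
    {β : ∀ n : ℕ, Fin (p n) → ℝ}
    {S : ∀ n, Set ((Fin n → Fin (p n) → ℝ) × (Fin n → ℝ))} (hS : ∀ n, MeasurableSet (S n))
    (h : Tendsto (fun n => gaussDesignVar n (p n) v (β n) (S n)) atTop (nhds 1)) :
    Tendsto (fun n => ((gaussDesignMatrix n (p n)).prod
      (Measure.pi fun _ : Fin n => gaussianReal 0 v)) {w | regObs (β n) w ∉ S n})
      atTop (nhds 0) := by
  have heq : ∀ n, ((gaussDesignMatrix n (p n)).prod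
      (Measure.pi fun _ : Fin n => gaussianReal 0 v)) {w | regObs (β n) w ∉ S n} =
      1 - gaussDesignVar n (p n) v (β n) (S n) := by
    intro n
    rw [← prob_compl_eq_one_sub (hS n), gaussDesignVar_eq_map_regObs,
      Measure.map_apply (measurable_regObs _) (hS n).compl]
    rfl
  simp_rw [heq]
  simpa using ENNReal.Tendsto.sub (tendsto_const_nhds (x := (1 : ℝ≥0∞))) h (Or.inl ENNReal.one_ne_top)

/-- Theorem 7 of the paper (Proposition under conditions D1–D4): a separably
penalized estimator with scalar thresholding behavior (D1), convergence rate
`r_n` (D2), bounded selected-model size (D3), and selection consistency under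
a beta-min condition (D4), makes no false discoveries asymptotically for all
configurations in `𝒟 ∩ 𝒟̃`, where
`𝒟̃ = { (s,p) : limsup s_n/p_n ≤ c < 1, p_n → ∞, √s_n · log p_n · r_n → 0 }`. -/
theorem separable_penalty_no_false_positive
    (σ : ℝ) (hσ : 0 < σ)
    (pfun : ℝ → ℕ → ℕ → ℝ) (h : ℕ → ℕ → ℝ)
    (𝒟 : Set ((ℕ → ℕ) × (ℕ → ℕ)))
    (r : ℕ → ℕ → ℕ → ℝ) (t : ℕ → ℕ → ℕ → ℝ) (C0 : ℝ) (hC0 : 0 < C0)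
    (c : ℝ) (hc : c < 1)
    (bh : ∀ n p : ℕ, (Fin n → Fin p → ℝ) × (Fin n → ℝ) → Fin p → ℝ)
    (hbmeas : ∀ n p, Measurable (bh n p))
    (hbmin : ∀ n p, IsSepPenEst n p σ pfun (bh n p))
    -- (D1): the scalar minimizer is nonzero iff the data exceeds the threshold
    (hD1 : ∀ (u : ℝ) (pn nn : ℕ) (b : ℝ),
      IsMinOn (fun b' : ℝ => (u - b') ^ 2 + σ ^ 2 * pfun b' pn nn) Set.univ b →
      (b ≠ 0 ↔ σ * h pn nn < |u|))
    -- (D2): convergence at rate `r_n`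
    (hD2 : ∀ s p : ℕ → ℕ, (s, p) ∈ 𝒟 → ∀ β : ∀ n : ℕ, Fin (p n) → ℝ,
      (∀ n, β n ∈ SparseV (p n) (s n)) →
      Tendsto
        (fun n => gaussDesignVar n (p n) (Real.toNNReal (σ ^ 2)) (β n)
          {w | Real.sqrt (∑ j, (bh n (p n) w j - β n j) ^ 2) ≤ r n (p n) (s n)})
        atTop (nhds 1))
    -- (D3): bounded selected-model size
    (hD3 : ∀ s p : ℕ → ℕ, (s, p) ∈ 𝒟 → ∀ β : ∀ n : ℕ, Fin (p n) → ℝ,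
      (∀ n, β n ∈ SparseV (p n) (s n)) →
      Tendsto
        (fun n => gaussDesignVar n (p n) (Real.toNNReal (σ ^ 2)) (β n)
          {w | (supp0 (bh n (p n) w) : ℝ) ≤ C0 * s n})
        atTop (nhds 1))
    -- (D4): selection consistency under the beta-min condition
    (hD4 : ∀ s p : ℕ → ℕ, (s, p) ∈ 𝒟 → ∀ β : ∀ n : ℕ, Fin (p n) → ℝ,
      (∀ n, β n ∈ SparseV (p n) (s n)) →
      (∀ n j, β n j ≠ 0 → t n (s n) (p n) ≤ |β n j|) →
      Tendsto
        (fun n => gaussDesignVar n (p n) (Real.toNNReal (σ ^ 2)) (β n)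
          {w | {j | bh n (p n) w j ≠ 0} = {j | β n j ≠ 0}})
        atTop (nhds 1)) :
    ∀ s p : ℕ → ℕ, (s, p) ∈ 𝒟 →
      limsup (fun n => (s n : ℝ) / p n) atTop ≤ c →
      Tendsto p atTop atTop →
      Tendsto (fun n => Real.sqrt (s n) * Real.log (p n) * r n (p n) (s n)) atTop (nhds 0) →
      ∀ β : ∀ n : ℕ, Fin (p n) → ℝ, (∀ n, β n ∈ SparseV (p n) (s n)) →
        Tendsto
          (fun n => gaussDesignVar n (p n) (Real.toNNReal (σ ^ 2)) (β n)
            {w | FPc (bh n (p n) w) (β n) = 0})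
          atTop (nhds 1) := by
  intro s p hsp _ hp hr β hβ
  let β' : ∀ n : ℕ, Fin (p n) → ℝ := fun n j => if β n j = 0 then 0 else |t n (s n) (p n)| + 1
  have hpos : ∀ n, 0 < |t n (s n) (p n)| + 1 := fun n => by positivity
  have hββ' : ∀ n j, β' n j = 0 ↔ β n j = 0 := by
    intro n j
    by_cases h0 : β n j = 0
    · simp [β', h0]
    · simp [β', h0, (hpos n).ne']
  have hβ' : ∀ n, β' n ∈ SparseV (p n) (s n) := by
    intro n
    have h1 : {j | β' n j ≠ 0} = {j | β n j ≠ 0} := by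
      ext j; exact not_congr (hββ' n j)
    change Set.ncard {j | β' n j ≠ 0} ≤ s n
    rw [h1]
    exact hβ n
  have hmin : ∀ n j, β' n j ≠ 0 → t n (s n) (p n) ≤ |β' n j| := by
    intro n j hj
    have h0 : ¬ β n j = 0 := fun h => hj ((hββ' n j).2 h)
    simp only [β', h0, if_false]
    rw [abs_of_pos (hpos n)]
    linarith [le_abs_self (t n (s n) (p n))]
  have hmeasD2 : ∀ (b : ∀ n : ℕ, Fin (p n) → ℝ) n, MeasurableSet
      {w | Real.sqrt (∑ j, (bh n (p n) w j - b n j) ^ 2) ≤ r n (p n) (s n)} := by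
    intro b n
    have := hbmeas n (p n)
    exact measurableSet_le (by fun_prop) measurable_const
  have d2 := tendsto_prod_compl_of_tendsto_gaussDesignVar (hmeasD2 β) (hD2 s p hsp β hβ)
  have d2' := tendsto_prod_compl_of_tendsto_gaussDesignVar (hmeasD2 β') (hD2 s p hsp β' hβ')
  have d3 := tendsto_prod_compl_of_tendsto_gaussDesignVar (fun n =>
    measurableSet_support_mem (hbmeas n (p n)) fun A => (A.ncard : ℝ) ≤ C0 * s n)
    (hD3 s p hsp β hβ)
  have d4 := tendsto_prod_compl_of_tendsto_gaussDesignVar (fun n =>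
    measurableSet_support_mem (hbmeas n (p n)) fun A => A = {j | β' n j ≠ 0})
    (hD4 s p hsp β' hβ' hmin)
  have hpinv : Tendsto (fun n => (p n : ℝ≥0∞)⁻¹) atTop (nhds 0) :=
    ENNReal.tendsto_inv_nat_nhds_zero.comp hp
  have hlog : ∀ᶠ n in atTop, 1 ≤ Real.log (p n) :=
    (Real.tendsto_log_atTop.comp (tendsto_natCast_atTop_atTop.comp hp)).eventually_ge_atTop 1
  have hrate : ∀ᶠ n in atTop, 3 * Real.sqrt (1 + C0) *
      (Real.sqrt (s n) * Real.log (p n) * r n (p n) (s n)) ≤ 1 := by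
    have h1 := hr.const_mul (3 * Real.sqrt (1 + C0))
    rw [mul_zero] at h1
    exact h1.eventually_le_const one_pos
  have hB := (d2'.add d4).add (ENNReal.Tendsto.const_mul hpinv (Or.inr ENNReal.ofNat_ne_top) :
    Tendsto (fun n => (2 : ℝ≥0∞) * (p n : ℝ≥0∞)⁻¹) atTop (nhds (2 * 0)))
  have hlim := ((d2.add d3).add hB).add (ENNReal.Tendsto.const_mul
    ((ENNReal.Tendsto.const_mul (a := ENNReal.ofReal (Real.exp ((6 * σ + 9 / 2) / σ ^ 2))) hB
      (Or.inr ENNReal.ofReal_ne_top)).add hpinv) (Or.inr (ENNReal.ofNat_ne_top (n := 2))))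
  simp only [mul_zero, add_zero] at hlim
  have hbad := tendsto_of_tendsto_of_tendsto_of_le_of_le' tendsto_const_nhds hlim
    (Eventually.of_forall fun n => zero_le) (by
      filter_upwards [eventually_gt_atTop 0, hlog, hrate] with n hn h1 h2
      exact measure_falsePositive_le_of_log hn h1 hσ (hbmin n (p n)) hC0 h2 (hβ n) (hββ' n)
        rfl rfl)
  have hgood : ∀ n, gaussDesignVar n (p n) (Real.toNNReal (σ ^ 2)) (β n)
      {w | FPc (bh n (p n) w) (β n) = 0} = 1 - ((gaussDesignMatrix n (p n)).prod
        (Measure.pi fun _ : Fin n => gaussianReal 0 (Real.toNNReal (σ ^ 2))))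
        {w | ¬ FPc (bh n (p n) (regObs (β n) w)) (β n) = 0} := by
    intro n
    have hm : MeasurableSet {w | FPc (bh n (p n) w) (β n) = 0} :=
      measurableSet_support_mem (hbmeas n (p n)) fun A => {j | j ∈ A ∧ β n j = 0}.ncard = 0
    have hm' := (measurable_regObs (β n)) hm
    rw [gaussDesignVar_eq_map_regObs, Measure.map_apply (measurable_regObs _) hm]
    have := prob_compl_eq_one_sub (μ := (gaussDesignMatrix n (p n)).prod
        (Measure.pi fun _ : Fin n => gaussianReal 0 (Real.toNNReal (σ ^ 2)))) hm'.compl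
    rwa [compl_compl] at this
  simp_rw [hgood]
  simpa using ENNReal.Tendsto.sub (tendsto_const_nhds (x := (1 : ℝ≥0∞))) hbad
    (Or.inl ENNReal.one_ne_top)
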